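/- Let 0 → A → B → C → 0 be a short exact sequence of R-modules with A and B quasi-Gorenstein projective. Then C is quasi-Gorenstein projective if and only if Ext^1(C, Q) = 0 for every quasi-projective module Q. -/

import Mathlib

open CategoryTheory

universe u
variable {R : Type u} [Ring R]

/-- A module `Q` is quasi-projective if every homomorphism from `Q` to a quotient
of `Q` lifts to an endomorphism of `Q`. -/
def QuasiProjective (Q : ModuleCat.{u} R) : Prop :=
  ∀ (B : ModuleCat.{u} R) (g : Q ⟶ B), Function.Surjective g →
    ∀ f : Q ⟶ B, ∃ h : Q ⟶ Q, h ≫ g = f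

/-- `M` is quasi-Gorenstein projective if it is a syzygy of an exact complex of
projective modules (given by short exact sequences `0 → K (n+1) → P n → K n → 0`)
that remains exact under `Hom(-, Q)` for every quasi-projective module `Q`. -/
def QuasiGorensteinProjective (M : ModuleCat.{u} R) : Prop :=
  ∃ (K P : ℤ → ModuleCat.{u} R) (ι : ∀ n, K (n + 1) ⟶ P n) (π : ∀ n, P n ⟶ K n),
    (∀ n, Module.Projective R (P n)) ∧
    (∀ n, Function.Injective (ι n)) ∧
    (∀ n, Function.Surjective (π n)) ∧
    (∀ n, Function.Exact (ι n) (π n)) ∧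
    (∀ n (Q : ModuleCat.{u} R), QuasiProjective Q →
      ∀ f : K (n + 1) ⟶ Q, ∃ g : P n ⟶ Q, ι n ≫ g = f) ∧
    Nonempty (M ≅ K 0)


/-- Unbundled short exact sequences. -/
structure QSes {X Y Z : Type u} [AddCommGroup X] [AddCommGroup Y] [AddCommGroup Z]
    [Module R X] [Module R Y] [Module R Z] (i : X →ₗ[R] Y) (p : Y →ₗ[R] Z) : Prop where
  inj : ∀ x, i x = 0 → x = 0
  surj : Function.Surjective p
  zero : ∀ x, p (i x) = 0
  ex : ∀ y, p y = 0 → ∃ x, i x = y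

section
variable {X Y Z T : Type u} [AddCommGroup X] [AddCommGroup Y] [AddCommGroup Z]
    [AddCommGroup T] [Module R X] [Module R Y] [Module R Z] [Module R T]
    {i : X →ₗ[R] Y} {p : Y →ₗ[R] Z}

theorem QSes.injective (h : QSes i p) : Function.Injective i :=
  (injective_iff_map_eq_zero i).2 h.inj

theorem QSes.lift (h : QSes i p) (t : T →ₗ[R] Y) (ht : ∀ x, p (t x) = 0) :
    ∃ s : T →ₗ[R] X, ∀ x, i (s x) = t x := by
  choose s hs using fun x => h.ex (t x) (ht x)
  refine ⟨{ toFun := s, map_add' := ?_, map_smul' := ?_ }, hs⟩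
  · intro a b; apply h.injective; simp [hs]
  · intro a b; apply h.injective; simp [hs]

theorem QSes.desc (h : QSes i p) (t : Y →ₗ[R] T) (ht : ∀ x, t (i x) = 0) :
    ∃ s : Z →ₗ[R] T, ∀ y, s (p y) = t y := by
  have key : ∀ y y', p y = p y' → t y = t y' := by
    intro y y' e
    obtain ⟨x, hx⟩ := h.ex (y - y') (by simp [e])
    have := ht x
    rw [hx, map_sub, sub_eq_zero] at this
    exact this
  choose s hs using h.surj
  refine ⟨{ toFun := fun z => t (s z), map_add' := ?_, map_smul' := ?_ }, ?_⟩
  · intro a b; rw [← map_add]; apply key; simp [hs]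
  · intro a b; rw [RingHom.id_apply, ← map_smul]; apply key; simp [hs]
  · intro y; exact key _ _ (hs _)

theorem QSes.ofSurj (p : Y →ₗ[R] Z) (hp : Function.Surjective p) :
    QSes (LinearMap.ker p).subtype p :=
  ⟨fun x hx => by simpa using hx, hp, fun x => x.2, fun y hy => ⟨⟨y, hy⟩, rfl⟩⟩

theorem QSes.ofInj (i : X →ₗ[R] Y) (hi : ∀ x, i x = 0 → x = 0) :
    QSes i (LinearMap.range i).mkQ :=
  ⟨hi, Submodule.mkQ_surjective _, fun x => by simp, fun y hy => by simpa using hy⟩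
end

/-- One-step Ext vanishing against all quasi-projectives, in terms of extending maps. -/
def QE1 (R : Type u) [Ring R] (G : Type u) [AddCommGroup G] [Module R G] : Prop :=
  ∀ (Q : ModuleCat.{u} R), QuasiProjective Q → ∀ (X Y : ModuleCat.{u} R)
    (i : X →ₗ[R] Y) (p : Y →ₗ[R] G), QSes i p → ∀ f : X →ₗ[R] Q,
    ∃ g : Y →ₗ[R] Q, ∀ x, g (i x) = f x

theorem QE1.use {G : Type u} [AddCommGroup G] [Module R G] (h : QE1 R G)
    {Q : Type u} [AddCommGroup Q] [Module R Q] (hQ : QuasiProjective (ModuleCat.of R Q))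
    {X Y : Type u} [AddCommGroup X] [AddCommGroup Y] [Module R X] [Module R Y]
    {i : X →ₗ[R] Y} {p : Y →ₗ[R] G} (hs : QSes i p) (f : X →ₗ[R] Q) :
    ∃ g : Y →ₗ[R] Q, ∀ x, g (i x) = f x :=
  h (ModuleCat.of R Q) hQ (ModuleCat.of R X) (ModuleCat.of R Y) i p hs f

theorem quasiProjective_of_projective (P : Type u) [AddCommGroup P] [Module R P]
    [Module.Projective R P] : QuasiProjective (ModuleCat.of R P) := by
  intro B g hg f
  obtain ⟨h, hh⟩ := Module.projective_lifting_property g.hom f.hom hg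
  exact ⟨ModuleCat.ofHom h, by ext x; exact LinearMap.congr_fun hh x⟩

theorem extend_of_presentation {G Q K P X Y : Type u} [AddCommGroup G] [Module R G]
    [AddCommGroup Q] [Module R Q] [AddCommGroup K] [Module R K]
    [AddCommGroup P] [Module R P] [AddCommGroup X] [Module R X] [AddCommGroup Y] [Module R Y]
    [Module.Projective R P] {j : K →ₗ[R] P} {q : P →ₗ[R] G} (hs : QSes j q)
    (hext : ∀ f : K →ₗ[R] Q, ∃ g : P →ₗ[R] Q, ∀ x, g (j x) = f x)
    {i : X →ₗ[R] Y} {p : Y →ₗ[R] G} (hp : QSes i p) (f : X →ₗ[R] Q) :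
    ∃ g : Y →ₗ[R] Q, ∀ x, g (i x) = f x := by
  obtain ⟨l, hl⟩ := Module.projective_lifting_property p q hp.surj
  have hl : ∀ x, p (l x) = q x := fun x => LinearMap.congr_fun hl x
  obtain ⟨k, hk⟩ := hp.lift (l ∘ₗ j) (fun x => by simp [hl, hs.zero])
  obtain ⟨e, he⟩ := hext (f ∘ₗ k)
  have hsurj : Function.Surjective (LinearMap.coprod l i) := by
    intro y
    obtain ⟨a, ha⟩ := hs.surj (p y)
    obtain ⟨x, hx⟩ := hp.ex (y - l a) (by simp [hl, ha])
    exact ⟨(a, x), by simp [hx]⟩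
  obtain ⟨g, hg⟩ := (QSes.ofSurj _ hsurj).desc (LinearMap.coprod e f) (by
    rintro ⟨⟨a, x⟩, h⟩
    have h : l a + i x = 0 := by simpa using h
    have ha : q a = 0 := by
      have := congrArg p h
      simpa [hl, hp.zero] using this
    obtain ⟨b, rfl⟩ := hs.ex a ha
    have hx : x = - k b := by
      apply hp.injective
      rw [map_neg, hk]
      exact eq_neg_of_add_eq_zero_right h
    subst hx
    simp [he])
  refine ⟨g, fun x => ?_⟩
  have := hg (0, x)
  simpa using this

theorem QE1.of_projective (P : Type u) [AddCommGroup P] [Module R P]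
    [Module.Projective R P] : QE1 R P := by
  intro Q hQ X Y i p hp f
  have hs : QSes (0 : PUnit.{u+1} →ₗ[R] P) (LinearMap.id : P →ₗ[R] P) :=
    ⟨fun _ _ => rfl, Function.surjective_id, fun _ => rfl, fun y hy => ⟨0, by simpa using hy.symm⟩⟩
  exact extend_of_presentation hs (fun f => ⟨0, fun x => by
    rw [Subsingleton.elim x 0, map_zero, map_zero, map_zero]⟩) hp f

theorem QE1.ext {B D A : Type u} [AddCommGroup B] [Module R B] [AddCommGroup D] [Module R D]
    [AddCommGroup A] [Module R A] {i : B →ₗ[R] D} {p : D →ₗ[R] A} (hs : QSes i p)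
    (hB : QE1 R B) (hA : QE1 R A) : QE1 R D := by
  intro Q hQ X Y j q hj f
  have h1 := QSes.ofSurj (p ∘ₗ q) (by
    rw [LinearMap.coe_comp]; exact hs.surj.comp hj.surj)
  obtain ⟨s, hs'⟩ := hs.lift (q ∘ₗ (LinearMap.ker (p ∘ₗ q)).subtype) (fun x => x.2)
  obtain ⟨k, hk⟩ := h1.lift j (fun x => by simp [hj.zero])
  have h2 : QSes k s := by
    refine ⟨fun x hx => hj.inj x ?_, ?_, ?_, ?_⟩
    · rw [← hk, hx, map_zero]
    · intro b
      obtain ⟨y, hy⟩ := hj.surj (i b)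
      refine ⟨⟨y, ?_⟩, ?_⟩
      · simp [hy, hs.zero]
      · apply hs.injective
        rw [hs']; exact hy
    · intro x
      apply hs.inj
      rw [hs', LinearMap.comp_apply, hk, hj.zero]
    · intro y hy
      obtain ⟨x, hx⟩ := hj.ex y.1 (by
        have := hs' y
        rw [hy, map_zero] at this
        exact this.symm)
      exact ⟨x, h1.injective (by rw [hk, hx]; rfl)⟩
  obtain ⟨g1, hg1⟩ := hB.use hQ h2 f
  obtain ⟨g2, hg2⟩ := hA.use hQ h1 g1
  exact ⟨g2, fun x => by rw [← hk, hg2, hg1]⟩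

/-- left step -/
def QLeft (𝒢 : ModuleCat.{u} R → Prop) (X : ModuleCat.{u} R) : Prop :=
  ∃ (K P : ModuleCat.{u} R) (i : K →ₗ[R] P) (p : P →ₗ[R] X), QSes i p ∧
    Module.Projective R P ∧ 𝒢 K

/-- right step -/
def QRight (𝒢 : ModuleCat.{u} R → Prop) (X : ModuleCat.{u} R) : Prop :=
  ∃ (P K : ModuleCat.{u} R) (i : X →ₗ[R] P) (p : P →ₗ[R] K), QSes i p ∧
    Module.Projective R P ∧ 𝒢 K

theorem qgp_coind (𝒢 : ModuleCat.{u} R → Prop)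
    (h : ∀ X, 𝒢 X → QE1 R X ∧ QLeft 𝒢 X ∧ QRight 𝒢 X) (M : ModuleCat.{u} R) (hM : 𝒢 M) :
    QuasiGorensteinProjective M := by
  let S := {X : ModuleCat.{u} R // 𝒢 X}
  let Rel : S → S → Prop := fun X Y => ∃ (P : ModuleCat.{u} R) (i : Y.1 →ₗ[R] P)
    (p : P →ₗ[R] X.1), QSes i p ∧ Module.Projective R P
  have hl : ∀ X : S, ∃ Y : S, Rel X Y := by
    rintro ⟨X, hX⟩
    obtain ⟨-, ⟨K, P, i, p, h1, h2, h3⟩, -⟩ := h X hX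
    exact ⟨⟨K, h3⟩, P, i, p, h1, h2⟩
  have hr : ∀ X : S, ∃ Y : S, Rel Y X := by
    rintro ⟨X, hX⟩
    obtain ⟨-, -, ⟨P, K, i, p, h1, h2, h3⟩⟩ := h X hX
    exact ⟨⟨K, h3⟩, P, i, p, h1, h2⟩
  choose l hl using hl
  choose r hr using hr
  let m : S := ⟨M, hM⟩
  let K : ℤ → S := fun n => match n with
    | Int.ofNat n => Nat.rec m (fun _ X => l X) n
    | Int.negSucc n => Nat.rec (r m) (fun _ X => r X) n
  have hK : ∀ n, Rel (K n) (K (n + 1)) := by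
    intro n
    match n with
    | Int.ofNat n => exact hl (K (Int.ofNat n))
    | Int.negSucc 0 => exact hr m
    | Int.negSucc (n + 1) =>
      have e : Int.negSucc (n + 1) + 1 = Int.negSucc n := by omega
      rw [e]
      exact hr (K (Int.negSucc n))
  choose P i p hs hP using hK
  refine ⟨fun n => (K n).1, P, fun n => ModuleCat.ofHom (i n), fun n => ModuleCat.ofHom (p n),
    hP, fun n => (hs n).injective, fun n => (hs n).surj, ?_, ?_, ⟨Iso.refl _⟩⟩
  · intro n y
    exact ⟨fun hy => (hs n).ex y hy, fun ⟨x, hx⟩ => by rw [← hx]; exact (hs n).zero x⟩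
  · intro n Q hQ f
    obtain ⟨g, hg⟩ := (h _ (K n).2).1.use (Q := Q) hQ (hs n) f.hom
    exact ⟨ModuleCat.ofHom g, by ext x; exact hg x⟩

theorem qgp_unfold (M : ModuleCat.{u} R) (hM : QuasiGorensteinProjective M) :
    QE1 R M ∧ QLeft QuasiGorensteinProjective M ∧ QRight QuasiGorensteinProjective M := by
  obtain ⟨K, P, ι, π, hP, hi, hp, hex, hQ, ⟨e0⟩⟩ := hM
  let 𝒢 : ModuleCat.{u} R → Prop := fun X => ∃ n, Nonempty (X ≅ K n)
  have key : ∀ X, 𝒢 X → QE1 R X ∧ QLeft 𝒢 X ∧ QRight 𝒢 X := by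
    rintro X ⟨n, ⟨e⟩⟩
    have e := e.toLinearEquiv
    have hs : ∀ n, QSes (ι n).hom (π n).hom := fun n =>
      ⟨fun x hx => hi n (by rw [map_zero]; exact hx), hp n,
        fun x => (hex n _).2 ⟨x, rfl⟩, fun y hy => (hex n y).1 hy⟩
    have hl : QSes (ι n).hom (e.symm.toLinearMap ∘ₗ (π n).hom) := by
      refine ⟨(hs n).inj, ?_, fun x => ?_, fun y hy => (hs n).ex y ?_⟩
      · rw [LinearMap.coe_comp]; exact e.symm.surjective.comp (hs n).surj
      · rw [LinearMap.comp_apply, (hs n).zero, map_zero]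
      · simpa using hy
    have := hP n
    refine ⟨?_, ⟨_, _, _, _, hl, hP n, n + 1, ⟨Iso.refl _⟩⟩, ?_⟩
    · intro Q hQ' A B i p hip f
      refine extend_of_presentation hl (fun f => ?_) hip f
      obtain ⟨g, hg⟩ := hQ n Q hQ' (ModuleCat.ofHom f)
      exact ⟨g.hom, fun x => by
        have := congrArg (fun t => t.hom x) hg
        exact this⟩
    · obtain ⟨m, rfl⟩ : ∃ m, n = m + 1 := ⟨n - 1, by ring⟩
      refine ⟨P m, K m, (ι m).hom ∘ₗ e.toLinearMap, (π m).hom, ?_, hP m, m, ⟨Iso.refl _⟩⟩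
      refine ⟨fun x hx => ?_, (hs m).surj, fun x => (hs m).zero _, fun y hy => ?_⟩
      · have := (hs m).inj _ hx
        simpa using this
      · obtain ⟨x, hx⟩ := (hs m).ex y hy
        exact ⟨e.symm x, by simpa using hx⟩
  have hG : ∀ X, 𝒢 X → QuasiGorensteinProjective X := qgp_coind 𝒢 key
  obtain ⟨h1, ⟨K1, P1, i1, p1, a1, b1, c1⟩, ⟨P2, K2, i2, p2, a2, b2, c2⟩⟩ := key M ⟨0, ⟨e0⟩⟩
  exact ⟨h1, ⟨K1, P1, i1, p1, a1, b1, hG _ c1⟩, ⟨P2, K2, i2, p2, a2, b2, hG _ c2⟩⟩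

theorem qgp_of_projective (P : ModuleCat.{u} R) (hP : Module.Projective R P) :
    QuasiGorensteinProjective P := by
  refine qgp_coind (fun X => Module.Projective R X) ?_ P hP
  intro X hX
  refine ⟨QE1.of_projective X, ⟨ModuleCat.of R PUnit, X, 0, LinearMap.id, ?_, hX, ?_⟩,
    ⟨X, ModuleCat.of R PUnit, LinearMap.id, 0, ?_, hX, ?_⟩⟩
  · exact ⟨fun _ _ => rfl, Function.surjective_id, fun _ => rfl,
      fun y hy => ⟨0, by simpa using hy.symm⟩⟩
  · exact (inferInstance : Module.Projective R PUnit.{u+1})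
  · exact ⟨fun _ h => h, fun _ => ⟨0, rfl⟩, fun _ => rfl, fun y _ => ⟨y, rfl⟩⟩
  · exact (inferInstance : Module.Projective R PUnit.{u+1})

theorem qgp_ext_closed {B D A : ModuleCat.{u} R} {i : B →ₗ[R] D} {p : D →ₗ[R] A}
    (hs : QSes i p) (hB : QuasiGorensteinProjective B) (hA : QuasiGorensteinProjective A) :
    QuasiGorensteinProjective D := by
  refine qgp_coind (fun D => ∃ (B A : ModuleCat.{u} R) (i : B →ₗ[R] D) (p : D →ₗ[R] A),
    QSes i p ∧ QuasiGorensteinProjective B ∧ QuasiGorensteinProjective A) ?_ D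
    ⟨B, A, i, p, hs, hB, hA⟩
  clear hs hB hA i p
  rintro D ⟨B, A, i, p, hs, hB, hA⟩
  obtain ⟨eB, ⟨KB, PB, iB, pB, sB, jB, gB⟩, ⟨PB', KB', iB', pB', sB', jB', gB'⟩⟩ :=
    qgp_unfold B hB
  obtain ⟨eA, ⟨KA, PA, iA, pA, sA, jA, gA⟩, ⟨PA', KA', iA', pA', sA', jA', gA'⟩⟩ :=
    qgp_unfold A hA
  refine ⟨eB.ext hs eA, ?_, ?_⟩
  · obtain ⟨l, hl⟩ := Module.projective_lifting_property p pA hs.surj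
    have hl : ∀ x, p (l x) = pA x := fun x => LinearMap.congr_fun hl x
    let q : PB × PA →ₗ[R] D := LinearMap.coprod (i ∘ₗ pB) l
    have hq : ∀ a b, q (a, b) = i (pB a) + l b := fun a b => by simp [q]
    have hqs : Function.Surjective q := by
      intro d
      obtain ⟨a, ha⟩ := sA.surj (p d)
      obtain ⟨b, hb⟩ := hs.ex (d - l a) (by simp [hl, ha])
      obtain ⟨c, rfl⟩ := sB.surj b
      exact ⟨(c, a), by simp [hq, hb]⟩
    have sq := QSes.ofSurj q hqs
    obtain ⟨u, hu⟩ := sq.lift (LinearMap.inl R PB PA ∘ₗ iB) (fun x => by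
      simp [hq, sB.zero])
    obtain ⟨v, hv⟩ := sA.lift (LinearMap.snd R PB PA ∘ₗ (LinearMap.ker q).subtype) (by
      rintro ⟨⟨a, b⟩, h⟩
      have h : i (pB a) + l b = 0 := by rw [← hq]; exact h
      have := congrArg p h
      simpa [hs.zero, hl] using this)
    refine ⟨ModuleCat.of R (LinearMap.ker q), ModuleCat.of R (PB × PA), _, q, sq,
      (inferInstance : Module.Projective R (PB × PA)), KB, KA, u, v, ?_, gB, gA⟩
    refine ⟨fun x hx => ?_, fun k => ?_, fun x => ?_, fun y hy => ?_⟩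
    · have := hu x
      rw [hx, map_zero] at this
      have := congrArg Prod.fst this
      exact sB.inj x this.symm
    · obtain ⟨b, hb⟩ := hs.ex (l (iA k)) (by rw [hl, sA.zero])
      obtain ⟨c, rfl⟩ := sB.surj b
      refine ⟨⟨(-c, iA k), ?_⟩, ?_⟩
      · change q _ = 0
        rw [hq, ← hb]; simp
      · apply sA.injective
        rw [hv]; rfl
    · apply sA.inj
      rw [hv, LinearMap.comp_apply, hu]; rfl
    · have h1 := hv y
      rw [hy, map_zero] at h1
      obtain ⟨⟨a, b⟩, h⟩ := y
      have hb : b = 0 := h1.symm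
      subst hb
      have h' : i (pB a) + l 0 = 0 := by rw [← hq]; exact h
      rw [map_zero, add_zero] at h'
      obtain ⟨x, hx⟩ := sB.ex a (hs.inj _ h')
      exact ⟨x, sq.injective (by rw [hu]; simp [hx])⟩
  · obtain ⟨t, ht⟩ := eA.use (quasiProjective_of_projective PB') hs iB'
    let w : D →ₗ[R] PB' × PA' := LinearMap.prod t (iA' ∘ₗ p)
    have hw : ∀ d, w d = (t d, iA' (p d)) := fun d => rfl
    have hwi : ∀ d, w d = 0 → d = 0 := by
      intro d hd
      rw [hw, Prod.mk_eq_zero] at hd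
      obtain ⟨b, rfl⟩ := hs.ex d (sA'.inj _ hd.2)
      rw [ht] at hd
      rw [sB'.inj _ hd.1, map_zero]
    have sw := QSes.ofInj w hwi
    obtain ⟨u, hu⟩ := sB'.desc ((LinearMap.range w).mkQ ∘ₗ LinearMap.inl R PB' PA') (by
      intro x
      have : w (i x) = (iB' x, 0) := by rw [hw, ht, hs.zero, map_zero]
      rw [LinearMap.comp_apply, LinearMap.inl_apply, ← this, sw.zero])
    obtain ⟨v, hv⟩ := sw.desc (pA' ∘ₗ LinearMap.snd R PB' PA') (fun x => by
      simp [hw, sA'.zero])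
    refine ⟨ModuleCat.of R (PB' × PA'), ModuleCat.of R ((PB' × PA') ⧸ LinearMap.range w), w,
      _, sw, (inferInstance : Module.Projective R (PB' × PA')), KB', KA', u, v, ?_, gB', gA'⟩
    refine ⟨fun x hx => ?_, fun k => ?_, fun x => ?_, fun y hy => ?_⟩
    · obtain ⟨a, rfl⟩ := sB'.surj x
      rw [hu] at hx
      obtain ⟨d, hd⟩ := sw.ex _ hx
      rw [hw, LinearMap.inl_apply, Prod.mk.injEq] at hd
      obtain ⟨b, rfl⟩ := hs.ex d (sA'.inj _ hd.2)
      rw [← hd.1, ht, sB'.zero]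
    · obtain ⟨a, rfl⟩ := sA'.surj k
      exact ⟨(LinearMap.range w).mkQ (0, a), by rw [hv]; rfl⟩
    · obtain ⟨a, rfl⟩ := sB'.surj x
      rw [hu, LinearMap.comp_apply, hv]; simp
    · obtain ⟨⟨a, b⟩, rfl⟩ := sw.surj y
      rw [hv] at hy
      obtain ⟨c, hc⟩ := sA'.ex b hy
      obtain ⟨d, rfl⟩ := hs.surj c
      refine ⟨pB' (a - t d), ?_⟩
      rw [hu, LinearMap.comp_apply, ← sub_eq_zero, ← map_sub]
      have : LinearMap.inl R PB' PA' (a - t d) - (a, b) = w (-d) := by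
        rw [hw, LinearMap.inl_apply, Prod.mk_sub_mk, ← hc]; simp
      rw [this, sw.zero]

theorem qgp_of_steps (C : ModuleCat.{u} R) (h1 : QE1 R C)
    (h2 : QLeft QuasiGorensteinProjective C) (h3 : QRight QuasiGorensteinProjective C) :
    QuasiGorensteinProjective C := by
  refine qgp_coind (fun X => X = C ∨ QuasiGorensteinProjective X) ?_ C (Or.inl rfl)
  have key : ∀ X : ModuleCat.{u} R, QE1 R X ∧ QLeft QuasiGorensteinProjective X ∧
      QRight QuasiGorensteinProjective X → QE1 R X ∧
      QLeft (fun X => X = C ∨ QuasiGorensteinProjective X) X ∧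
      QRight (fun X => X = C ∨ QuasiGorensteinProjective X) X := by
    rintro X ⟨h1, ⟨K1, P1, i1, p1, a1, b1, c1⟩, ⟨P2, K2, i2, p2, a2, b2, c2⟩⟩
    exact ⟨h1, ⟨K1, P1, i1, p1, a1, b1, Or.inr c1⟩, ⟨P2, K2, i2, p2, a2, b2, Or.inr c2⟩⟩
  rintro X (rfl | hX)
  · exact key _ ⟨h1, h2, h3⟩
  · exact key _ (qgp_unfold X hX)

theorem qgp_third {A B C : ModuleCat.{u} R} {f : A →ₗ[R] B} {g : B →ₗ[R] C}
    (hs : QSes f g) (hA : QuasiGorensteinProjective A) (hB : QuasiGorensteinProjective B)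
    (hC : QE1 R C) : QuasiGorensteinProjective C := by
  refine qgp_of_steps C hC ?_ ?_
  · obtain ⟨-, ⟨K, P, i, p, s, j, hK⟩, -⟩ := qgp_unfold B hB
    have sq := QSes.ofSurj (g ∘ₗ p) (by
      rw [LinearMap.coe_comp]; exact hs.surj.comp s.surj)
    obtain ⟨u, hu⟩ := sq.lift i (fun x => by simp [s.zero])
    obtain ⟨v, hv⟩ := hs.lift (p ∘ₗ (LinearMap.ker (g ∘ₗ p)).subtype) (fun x => x.2)
    refine ⟨ModuleCat.of R (LinearMap.ker (g ∘ₗ p)), P, _, _, sq, j, ?_⟩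
    refine qgp_ext_closed (B := K) (A := A) (i := u) (p := v) ?_ hK hA
    refine ⟨fun x hx => ?_, fun a => ?_, fun x => ?_, fun y hy => ?_⟩
    · apply s.inj
      rw [← hu, hx, map_zero]
    · obtain ⟨y, hy⟩ := s.surj (f a)
      refine ⟨⟨y, ?_⟩, ?_⟩
      · simp [hy, hs.zero]
      · apply hs.injective
        rw [hv]; exact hy
    · apply hs.inj
      rw [hv, LinearMap.comp_apply, hu, s.zero]
    · have h1 := hv y
      rw [hy, map_zero] at h1
      obtain ⟨x, hx⟩ := s.ex _ h1.symm
      exact ⟨x, sq.injective (by rw [hu, hx])⟩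
  · obtain ⟨-, -, ⟨P, A', i, p, s, j, hA'⟩⟩ := qgp_unfold A hA
    obtain ⟨φ, hφ⟩ := hC.use (quasiProjective_of_projective P) hs i
    obtain ⟨c, hc⟩ := hs.desc (p ∘ₗ φ) (fun x => by simp [hφ, s.zero])
    have hD : QuasiGorensteinProjective (ModuleCat.of R (C × P)) := by
      refine qgp_ext_closed (B := B) (A := A') (i := LinearMap.prod g φ)
        (p := LinearMap.coprod (-c) p) ?_ hB hA'
      refine ⟨fun x hx => ?_, fun a => ?_, fun x => ?_, ?_⟩
      · have h1 : g x = 0 := congrArg Prod.fst hx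
        have h2 : φ x = 0 := congrArg Prod.snd hx
        obtain ⟨a, rfl⟩ := hs.ex x h1
        rw [hφ] at h2
        rw [s.inj _ h2, map_zero]
      · obtain ⟨y, rfl⟩ := s.surj a
        exact ⟨(0, y), by simp⟩
      · simp [hc]
      · rintro ⟨x, y⟩ h
        have h : -c x + p y = 0 := by simpa using h
        obtain ⟨b, rfl⟩ := hs.surj x
        rw [hc, LinearMap.comp_apply, ← map_neg, ← map_add] at h
        obtain ⟨a, ha⟩ := s.ex _ h
        refine ⟨b + f a, ?_⟩
        rw [LinearMap.prod_apply]
        simp [hs.zero, hφ, ha]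
    obtain ⟨-, -, ⟨F, D', m, n, t, k, hD'⟩⟩ := qgp_unfold _ hD
    let m' : C × P →ₗ[R] F := m
    have t : QSes m' n := t
    have sw := QSes.ofInj (m' ∘ₗ LinearMap.inl R C P) (fun x hx => by
      have := t.inj _ hx
      exact congrArg Prod.fst this)
    obtain ⟨v, hv⟩ := sw.desc n (fun x => t.zero _)
    refine ⟨F, ModuleCat.of R (F ⧸ LinearMap.range (m' ∘ₗ LinearMap.inl R C P)), _, _, sw, k, ?_⟩
    refine qgp_ext_closed (B := P) (A := D')
      (i := (LinearMap.range (m' ∘ₗ LinearMap.inl R C P)).mkQ ∘ₗ m' ∘ₗ LinearMap.inr R C P)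
      (p := v) ?_ (qgp_of_projective P j) hD'
    refine ⟨fun x hx => ?_, fun a => ?_, fun x => ?_, fun y hy => ?_⟩
    · obtain ⟨z, hz⟩ := sw.ex _ hx
      have := t.injective hz
      exact (congrArg Prod.snd this).symm
    · obtain ⟨y, rfl⟩ := t.surj a
      exact ⟨_, hv y⟩
    · rw [LinearMap.comp_apply, hv]
      exact t.zero _
    · obtain ⟨y, rfl⟩ := sw.surj y
      rw [hv] at hy
      obtain ⟨⟨a, b⟩, rfl⟩ := t.ex y hy
      refine ⟨b, ?_⟩
      rw [LinearMap.comp_apply, ← sub_eq_zero, ← map_sub]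
      have : (m' ∘ₗ LinearMap.inr R C P) b - m' (a, b) = (m' ∘ₗ LinearMap.inl R C P) (-a) := by
        rw [LinearMap.comp_apply, LinearMap.comp_apply, ← map_sub]; simp
      rw [this, sw.zero]

theorem ext_one_subsingleton_iff {C : ModuleCat.{u} R} (P : ProjectiveResolution C)
    (Q : ModuleCat.{u} R) :
    Subsingleton (((Ext ℤ (ModuleCat.{u} R) 1).obj (Opposite.op C)).obj Q) ↔
    ∀ φ : P.complex.X 1 ⟶ Q, P.complex.d 2 1 ≫ φ = 0 →
      ∃ ψ : P.complex.X 0 ⟶ Q, P.complex.d 1 0 ≫ ψ = φ := by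
  rw [← ModuleCat.isZero_iff_subsingleton, (P.isoExt (R := ℤ) 1 Q).isZero_iff,
    ← HomologicalComplex.exactAt_iff_isZero_homology,
    HomologicalComplex.exactAt_iff' _ 0 1 2 (by simp) (by simp),
    ShortComplex.moduleCat_exact_iff]
  rfl

theorem qe1_iff (C : ModuleCat.{u} R) :
    QE1 R C ↔ ∀ Q : ModuleCat.{u} R, QuasiProjective Q →
        Subsingleton (((Ext ℤ (ModuleCat.{u} R) 1).obj (Opposite.op C)).obj Q) := by
  obtain ⟨P⟩ : Nonempty (ProjectiveResolution C) := HasProjectiveResolution.out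
  have ex0 := P.exact₀
  have ex1 := P.exact_succ 0
  rw [ShortComplex.moduleCat_exact_iff] at ex0 ex1
  have hsurj : Function.Surjective (P.π.f 0) :=
    (ModuleCat.epi_iff_surjective _).1 inferInstance
  let q : P.complex.X 0 →ₗ[R] C := (P.π.f 0).hom
  have sq : QSes (LinearMap.ker q).subtype q := QSes.ofSurj q hsurj
  have hz : ∀ x, q ((P.complex.d 1 0).hom x) = 0 := fun x =>
    congrArg (fun t => t.hom x) P.complex_d_comp_π_f_zero
  obtain ⟨d, hd⟩ := sq.lift (P.complex.d 1 0).hom hz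
  have hdd : ∀ x, (P.complex.d 1 0).hom ((P.complex.d 2 1).hom x) = 0 := fun x =>
    congrArg (fun t => t.hom x) (P.complex.d_comp_d 2 1 0)
  have sd : QSes (LinearMap.ker d).subtype d := QSes.ofSurj d (by
    rintro ⟨y, hy⟩
    obtain ⟨x, hx⟩ := ex0 y hy
    exact ⟨x, sq.injective (by rw [hd]; exact hx)⟩)
  have hproj : Module.Projective R (P.complex.X 0) :=
    (IsProjective.iff_projective _).2 (P.projective 0)
  refine forall_congr' fun Q => ?_
  refine forall_congr' fun hQ => ?_
  rw [ext_one_subsingleton_iff P]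
  constructor
  · intro h φ hφ
    obtain ⟨ψ, hψ⟩ := sd.desc φ.hom (by
      rintro ⟨x, hx⟩
      obtain ⟨z, rfl⟩ := ex1 x (by
        have := hd x
        rw [show d x = 0 from hx] at this
        exact this.symm)
      exact congrArg (fun t => t.hom z) hφ)
    obtain ⟨g, hg⟩ := h (ModuleCat.of R (LinearMap.ker q)) (P.complex.X 0) _ _ sq ψ
    refine ⟨ModuleCat.ofHom g, ?_⟩
    ext x
    change g ((P.complex.d 1 0).hom x) = φ.hom x
    rw [← hψ, ← hd]
    exact hg _
  · intro h X Y i p hip f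
    refine extend_of_presentation sq (fun f => ?_) hip f
    obtain ⟨ψ, hψ⟩ := h (ModuleCat.ofHom (f ∘ₗ d)) (by
      ext x
      change f (d ((P.complex.d 2 1).hom x)) = 0
      rw [show d ((P.complex.d 2 1).hom x) = 0 from sq.injective (by rw [hd, hdd]; rfl),
        map_zero])
    refine ⟨ψ.hom, fun x => ?_⟩
    obtain ⟨y, rfl⟩ := sd.surj x
    rw [hd]
    exact congrArg (fun t => t.hom y) hψ

/-- For a short exact sequence `0 → A → B → C → 0` with `A` and `B`
quasi-Gorenstein projective, `C` is quasi-Gorenstein projective iff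
`Ext^1(C, Q) = 0` for every quasi-projective `Q`. -/
theorem quasiGorensteinProjective_iff_ext_one_vanishing
    {A B C : ModuleCat.{u} R} (f : A ⟶ B) (g : B ⟶ C)
    (hf : Function.Injective f) (hg : Function.Surjective g)
    (hfg : Function.Exact f g)
    (hA : QuasiGorensteinProjective A) (hB : QuasiGorensteinProjective B) :
    QuasiGorensteinProjective C ↔
      ∀ Q : ModuleCat.{u} R, QuasiProjective Q →
        Subsingleton (((Ext ℤ (ModuleCat.{u} R) 1).obj (Opposite.op C)).obj Q) := by
  rw [← qe1_iff]
  constructor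
  · exact fun h => (qgp_unfold C h).1
  · refine fun h => qgp_third (f := f.hom) (g := g.hom) ?_ hA hB h
    exact ⟨fun x hx => hf (by rw [map_zero]; exact hx), hg,
      fun x => (hfg _).2 ⟨x, rfl⟩, fun y hy => (hfg y).1 hy⟩
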